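/- Let K = u/v be shift-reduced with K ≠ 1, let a, b ∈ F[y] with b nonzero, shift-free, and strongly prime with K, and let ℓ be an integer such that σ^ℓ(b) is strongly prime with K. Then there exist c, q ∈ F[y] with deg(c) < deg(b) and q ∈ W_K such that a/b − (c/σ^ℓ(b) + q/v) belongs to V_K; in particular c/σ^ℓ(b) + q/v is a residual form of a/b with respect to K. -/

import Mathlib

open Polynomial

noncomputable def pshift (F : Type*) [Field F] (i : ℤ) :
    Polynomial F →ₐ[F] Polynomial F :=
  aeval (X + C (i : F))

noncomputable def rshift (F : Type*) [Field F] (i : ℤ) : RatFunc F → RatFunc F :=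
  fun f => RatFunc.mk (pshift F i f.num) (pshift F i f.denom)

def shiftFree {F : Type*} [Field F] (p : Polynomial F) : Prop :=
  p ≠ 0 ∧ ∀ i : ℤ, i ≠ 0 → IsCoprime p (pshift F i p)

def shiftReducedPair {F : Type*} [Field F] (u v : Polynomial F) : Prop :=
  u ≠ 0 ∧ v ≠ 0 ∧ IsCoprime u v ∧ ∀ i : ℤ, IsCoprime u (pshift F i v)

def stronglyPrime {F : Type*} [Field F] (p u v : Polynomial F) : Prop :=
  p ≠ 0 ∧ ∀ i : ℕ, IsCoprime p (pshift F (-(i : ℤ)) u) ∧ IsCoprime p (pshift F (i : ℤ) v)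

noncomputable def phiK {F : Type*} [Field F] (u v : Polynomial F) :
    Polynomial F → Polynomial F :=
  fun p => u * pshift F 1 p - v * p

noncomputable def WK (F : Type*) [Field F] (u v : Polynomial F) :
    Submodule F (Polynomial F) :=
  Submodule.span F {q : Polynomial F | ∃ ℓ : ℕ, q = X ^ ℓ ∧
    ∀ w : Polynomial F, w ∈ Set.range (phiK u v) → w ≠ 0 → ℓ ≠ w.natDegree}

def VK {F : Type*} [Field F] (K : RatFunc F) : Set (RatFunc F) :=
  {g | ∃ r : RatFunc F, g = K * rshift F 1 r - r}

def residualForm {F : Type*} [Field F] (u v : Polynomial F) (r : RatFunc F) : Prop :=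
  ∃ a b q : Polynomial F, a.degree < b.degree ∧ shiftFree b ∧ stronglyPrime b u v ∧
    q ∈ WK F u v ∧ r = RatFunc.mk a b + RatFunc.mk q v

theorem pshift_eq_taylor {F : Type*} [Field F] (i : ℤ) (p : F[X]) :
    pshift F i p = taylor (i : F) p := by
  simp [pshift, taylor_apply, comp, aeval_def, algebraMap_eq]

theorem pshift_pshift {F : Type*} [Field F] (i j : ℤ) (p : F[X]) :
    pshift F i (pshift F j p) = pshift F (i + j) p := by
  simp [pshift_eq_taylor, taylor_taylor]

theorem pshift_zero {F : Type*} [Field F] (p : F[X]) : pshift F 0 p = p := by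
  simp [pshift_eq_taylor]

theorem degree_pshift {F : Type*} [Field F] (i : ℤ) (p : F[X]) :
    (pshift F i p).degree = p.degree := by
  simp [pshift_eq_taylor]

theorem pshift_ne_zero {F : Type*} [Field F] {p : F[X]} (hp : p ≠ 0) (i : ℤ) :
    pshift F i p ≠ 0 := by
  rwa [← degree_ne_bot, degree_pshift, degree_ne_bot]

theorem isCoprime_pshift {F : Type*} [Field F] {p q : F[X]} (h : IsCoprime p q) (i : ℤ) :
    IsCoprime (pshift F i p) (pshift F i q) :=
  h.map (pshift F i).toRingHom

theorem shiftFree_pshift {F : Type*} [Field F] {p : F[X]} (h : shiftFree p) (i : ℤ) :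
    shiftFree (pshift F i p) := by
  refine ⟨pshift_ne_zero h.1 i, fun j hj => ?_⟩
  have := isCoprime_pshift (h.2 j hj) i
  rwa [pshift_pshift, add_comm, ← pshift_pshift] at this

theorem rshift_div {F : Type*} [Field F] (i : ℤ) (p : F[X]) {q : F[X]} (hq : q ≠ 0) :
    rshift F i (algebraMap F[X] (RatFunc F) p / algebraMap F[X] (RatFunc F) q) =
      algebraMap F[X] (RatFunc F) (pshift F i p) / algebraMap F[X] (RatFunc F) (pshift F i q) := by
  set f := algebraMap F[X] (RatFunc F) p / algebraMap F[X] (RatFunc F) q with hf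
  have h : f.num * q = p * f.denom := by
    have hq' := RatFunc.algebraMap_ne_zero hq
    have hd := RatFunc.algebraMap_ne_zero f.denom_ne_zero
    have := f.num_div_denom
    nth_rewrite 3 [hf] at this
    rw [div_eq_div_iff hd hq'] at this
    exact RatFunc.algebraMap_injective F (by simpa using this)
  have h' := congrArg (fun x => algebraMap F[X] (RatFunc F) (pshift F i x)) h
  simp only [map_mul] at h'
  rw [rshift, RatFunc.mk_eq_div, div_eq_div_iff
    (RatFunc.algebraMap_ne_zero (pshift_ne_zero f.denom_ne_zero i))
    (RatFunc.algebraMap_ne_zero (pshift_ne_zero hq i))]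
  exact h'

theorem rshift_add {F : Type*} [Field F] (i : ℤ) (f g : RatFunc F) :
    rshift F i (f + g) = rshift F i f + rshift F i g := by
  have hf := RatFunc.algebraMap_ne_zero f.denom_ne_zero
  have hg := RatFunc.algebraMap_ne_zero g.denom_ne_zero
  have hf' := RatFunc.algebraMap_ne_zero (pshift_ne_zero f.denom_ne_zero i)
  have hg' := RatFunc.algebraMap_ne_zero (pshift_ne_zero g.denom_ne_zero i)
  have h : f + g = algebraMap F[X] (RatFunc F) (f.num * g.denom + f.denom * g.num) /
      algebraMap F[X] (RatFunc F) (f.denom * g.denom) := by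
    conv_lhs => rw [← f.num_div_denom, ← g.num_div_denom, div_add_div _ _ hf hg]
    simp only [map_mul, map_add]
  rw [h, rshift_div i _ (mul_ne_zero f.denom_ne_zero g.denom_ne_zero), rshift, rshift,
    RatFunc.mk_eq_div, RatFunc.mk_eq_div, div_add_div _ _ hf' hg']
  simp only [map_mul, map_add]

theorem add_mem_VK {F : Type*} [Field F] {K f g : RatFunc F} (hf : f ∈ VK K) (hg : g ∈ VK K) :
    f + g ∈ VK K := by
  obtain ⟨r, rfl⟩ := hf
  obtain ⟨s, rfl⟩ := hg
  exact ⟨r + s, by rw [rshift_add]; ring⟩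

theorem div_mem_VK {F : Type*} [Field F] (u v s : F[X]) {b : F[X]} (hb : b ≠ 0) :
    RatFunc.mk u v * RatFunc.mk (pshift F 1 s) (pshift F 1 b) - RatFunc.mk s b
      ∈ VK (RatFunc.mk u v) := by
  refine ⟨RatFunc.mk s b, ?_⟩
  rw [RatFunc.mk_eq_div s b, rshift_div 1 s hb, RatFunc.mk_eq_div (pshift F 1 s)]

theorem phiK_div_mem_VK {F : Type*} [Field F] (u s : F[X]) {v : F[X]} (hv : v ≠ 0) :
    RatFunc.mk (phiK u v s) v ∈ VK (RatFunc.mk u v) := by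
  convert div_mem_VK u v s one_ne_zero using 1
  have hv' := RatFunc.algebraMap_ne_zero hv
  simp only [RatFunc.mk_eq_div, phiK, map_sub, map_mul, map_one]
  field_simp

theorem exists_sub_phiK_mem_WK {F : Type*} [Field F] (u v p : F[X]) :
    ∃ s : F[X], p - phiK u v s ∈ WK F u v := by
  suffices h : ∀ n : ℕ, ∀ p : F[X], p.degree < n → ∃ s : F[X], p - phiK u v s ∈ WK F u v from
    h (p.natDegree + 1) p (degree_lt_iff_coeff_zero _ _ |>.2 fun m hm =>
      coeff_eq_zero_of_natDegree_lt hm)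
  intro n
  induction n with
  | zero =>
    intro p hp
    have : p = 0 := by simpa [degree_lt_iff_coeff_zero, Polynomial.ext_iff] using hp
    exact ⟨0, by simp [this, phiK]⟩
  | succ n ih =>
    intro p hp
    rw [degree_lt_iff_coeff_zero] at hp
    by_cases h : ∃ s : F[X], phiK u v s ≠ 0 ∧ n = (phiK u v s).natDegree
    · obtain ⟨s, hs, hn⟩ := h
      have hlc : (phiK u v s).coeff n ≠ 0 := by
        rw [hn]; exact leadingCoeff_ne_zero.2 hs
      obtain ⟨t, ht⟩ := ih (p - C (p.coeff n / (phiK u v s).coeff n) * phiK u v s) (by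
        rw [degree_lt_iff_coeff_zero]
        intro m hm
        rcases hm.eq_or_lt with rfl | hm
        · simp [hlc]
        · simp [hp m hm, coeff_eq_zero_of_natDegree_lt (hn ▸ hm : (phiK u v s).natDegree < m)])
      refine ⟨C (p.coeff n / (phiK u v s).coeff n) * s + t, ?_⟩
      convert ht using 1
      generalize p.coeff n / (phiK u v s).coeff n = c
      have hc : pshift F 1 (C c) = C c := by simp [pshift_eq_taylor]
      simp only [phiK, map_add, map_mul, hc]
      ring
    · push Not at h
      obtain ⟨t, ht⟩ := ih (p - p.coeff n • X ^ n) (by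
        rw [degree_lt_iff_coeff_zero]
        intro m hm
        rcases hm.eq_or_lt with rfl | hm
        · simp
        · simp [hp m hm, coeff_X_pow, hm.ne'])
      refine ⟨t, ?_⟩
      have hX : (X ^ n : F[X]) ∈ WK F u v :=
        Submodule.subset_span ⟨n, rfl, by rintro _ ⟨s, rfl⟩ hs; exact h s hs⟩
      convert add_mem ht (Submodule.smul_mem _ (p.coeff n) hX) using 1
      ring

theorem exists_forward_shift {F : Type*} [Field F] (u a : F[X]) {v b : F[X]} (hv : v ≠ 0)
    (hb : b ≠ 0) (h : IsCoprime (pshift F 1 b) v) :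
    ∃ c t : F[X], RatFunc.mk a b - (RatFunc.mk c (pshift F 1 b) + RatFunc.mk t v)
      ∈ VK (RatFunc.mk u v) := by
  obtain ⟨x, y, hxy⟩ := h
  refine ⟨u * pshift F 1 a * y, u * pshift F 1 a * x, ?_⟩
  convert div_mem_VK u v (-a) hb using 1
  have hv' := RatFunc.algebraMap_ne_zero hv
  have hb' := RatFunc.algebraMap_ne_zero hb
  have hc' := RatFunc.algebraMap_ne_zero (pshift_ne_zero hb 1)
  have := congrArg (algebraMap F[X] (RatFunc F)) hxy
  simp only [map_add, map_mul, map_one] at this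
  simp only [RatFunc.mk_eq_div, map_mul, map_neg]
  field_simp
  linear_combination (-algebraMap F[X] (RatFunc F) b * algebraMap F[X] (RatFunc F) u *
    algebraMap F[X] (RatFunc F) (pshift F 1 a)) * this

theorem exists_backward_shift {F : Type*} [Field F] (u a : F[X]) {v b : F[X]} (hv : v ≠ 0)
    (hb : b ≠ 0) (h : IsCoprime b u) :
    ∃ c t : F[X], RatFunc.mk a b - (RatFunc.mk c (pshift F (-1) b) + RatFunc.mk t v)
      ∈ VK (RatFunc.mk u v) := by
  obtain ⟨x, y, hxy⟩ := h
  refine ⟨pshift F (-1) (a * v * y), a * v * x, ?_⟩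
  convert div_mem_VK u v (pshift F (-1) (a * v * y)) (pshift_ne_zero hb (-1)) using 1
  rw [pshift_pshift, pshift_pshift, add_neg_cancel, pshift_zero, pshift_zero]
  have hv' := RatFunc.algebraMap_ne_zero hv
  have hb' := RatFunc.algebraMap_ne_zero hb
  have hc' := RatFunc.algebraMap_ne_zero (pshift_ne_zero hb (-1))
  have := congrArg (algebraMap F[X] (RatFunc F)) hxy
  simp only [map_add, map_mul, map_one] at this
  generalize pshift F (-1) (a * v * y) = s
  rw [← sub_sub, sub_right_comm, sub_left_inj]
  simp only [RatFunc.mk_eq_div, map_mul]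
  field_simp
  linear_combination (-algebraMap F[X] (RatFunc F) a) * this

theorem sub_mem_VK_trans {F : Type*} [Field F] {K : RatFunc F} {f g : RatFunc F}
    {v t t' : F[X]} {w : RatFunc F} (hf : f - (g + RatFunc.mk t v) ∈ VK K)
    (hg : g - (w + RatFunc.mk t' v) ∈ VK K) :
    f - (w + RatFunc.mk (t + t') v) ∈ VK K := by
  convert add_mem_VK hf hg using 1
  simp only [RatFunc.mk_eq_div, map_add]
  ring

theorem exists_forward_shift_nat {F : Type*} [Field F] (u a : F[X]) {v b : F[X]} (hv : v ≠ 0)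
    (hb : b ≠ 0) (n : ℕ) (h : ∀ j : ℕ, j < n → IsCoprime (pshift F (j + 1) b) v) :
    ∃ c t : F[X], RatFunc.mk a b - (RatFunc.mk c (pshift F n b) + RatFunc.mk t v)
      ∈ VK (RatFunc.mk u v) := by
  induction n with
  | zero => exact ⟨a, 0, 0, by simp [pshift_zero, RatFunc.mk_eq_div, rshift]⟩
  | succ n ih =>
    obtain ⟨c, t, hct⟩ := ih fun j hj => h j (by lia)
    have hn := h n (by lia)
    rw [add_comm, ← pshift_pshift] at hn
    obtain ⟨c', t', hct'⟩ := exists_forward_shift u c hv (pshift_ne_zero hb n) hn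
    rw [pshift_pshift, add_comm 1] at hct'
    exact ⟨c', t + t', by simpa using sub_mem_VK_trans hct hct'⟩

theorem exists_backward_shift_nat {F : Type*} [Field F] (u a : F[X]) {v b : F[X]} (hv : v ≠ 0)
    (hb : b ≠ 0) (n : ℕ) (h : ∀ j : ℕ, j < n → IsCoprime (pshift F (-j) b) u) :
    ∃ c t : F[X], RatFunc.mk a b - (RatFunc.mk c (pshift F (-n) b) + RatFunc.mk t v)
      ∈ VK (RatFunc.mk u v) := by
  induction n with
  | zero => exact ⟨a, 0, 0, by simp [pshift_zero, RatFunc.mk_eq_div, rshift]⟩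
  | succ n ih =>
    obtain ⟨c, t, hct⟩ := ih fun j hj => h j (by lia)
    obtain ⟨c', t', hct'⟩ := exists_backward_shift u c hv (pshift_ne_zero hb (-n)) (h n (by lia))
    rw [pshift_pshift] at hct'
    refine ⟨c', t + t', ?_⟩
    rw [Nat.cast_add, Nat.cast_one, neg_add_rev]
    exact sub_mem_VK_trans hct hct'

theorem exists_shift {F : Type*} [Field F] (a : F[X]) {u v b : F[X]} (hv : v ≠ 0) (hb : b ≠ 0)
    (ℓ : ℤ) (hbl : stronglyPrime (pshift F ℓ b) u v) :
    ∃ c t : F[X], RatFunc.mk a b - (RatFunc.mk c (pshift F ℓ b) + RatFunc.mk t v)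
      ∈ VK (RatFunc.mk u v) := by
  obtain ⟨n, rfl | rfl⟩ := ℓ.eq_nat_or_neg
  · refine exists_forward_shift_nat u a hv hb n fun j hj => ?_
    have := isCoprime_pshift (hbl.2 (n - 1 - j)).2 (-((n - 1 - j : ℕ) : ℤ))
    rw [pshift_pshift, pshift_pshift, neg_add_cancel, pshift_zero] at this
    convert this using 3
    lia
  · refine exists_backward_shift_nat u a hv hb n fun j hj => ?_
    have := isCoprime_pshift (hbl.2 (n - j)).1 (n - j : ℕ)
    rw [pshift_pshift, pshift_pshift, add_neg_cancel, pshift_zero] at this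
    convert this using 3
    lia

/-- a/b has a residual form c/σ^ℓ(b) + q/v with deg c < deg b and q ∈ W_K. -/
theorem stmt18 {F : Type*} [Field F] [CharZero F] (u v a b : Polynomial F) (ℓ : ℤ)
    (hsr : shiftReducedPair u v) (hK1 : RatFunc.mk u v ≠ 1)
    (hb : shiftFree b) (hbsp : stronglyPrime b u v)
    (hbl : stronglyPrime (pshift F ℓ b) u v) :
    ∃ c q : Polynomial F, c.degree < b.degree ∧ q ∈ WK F u v ∧
      RatFunc.mk a b - (RatFunc.mk c (pshift F ℓ b) + RatFunc.mk q v)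
        ∈ VK (RatFunc.mk u v) ∧
      residualForm u v (RatFunc.mk c (pshift F ℓ b) + RatFunc.mk q v) := by
  have hv := hsr.2.1
  have hbl0 := pshift_ne_zero hb.1 ℓ
  obtain ⟨c, t, hct⟩ := exists_shift a hv hb.1 ℓ hbl
  set B := pshift F ℓ b with hB
  obtain ⟨s, hs⟩ := exists_sub_phiK_mem_WK u v (t + v * (c / B))
  set q := t + v * (c / B) - phiK u v s with hq
  have hdeg : (c % B).degree < b.degree := by
    rw [← degree_pshift ℓ b]
    exact EuclideanDomain.mod_lt c hbl0
  refine ⟨c % B, q, hdeg, hs, ?_, c % B, B, q, ?_, shiftFree_pshift hb ℓ, hbl, hs, rfl⟩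
  · convert add_mem_VK hct (phiK_div_mem_VK u s hv) using 1
    have hv' := RatFunc.algebraMap_ne_zero hv
    have hB' := RatFunc.algebraMap_ne_zero hbl0
    have := congrArg (algebraMap F[X] (RatFunc F)) (EuclideanDomain.div_add_mod c B)
    simp only [map_add, map_mul] at this
    simp only [RatFunc.mk_eq_div, hq, map_sub, map_add, map_mul, ← this]
    field_simp
    ring
  · rwa [hB, degree_pshift]
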